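/- Let G be a finite group and let (X, X') be an r-encoding pair. Set R' := Ĥ^0(G, Hom_ℤ(X', X')), a ring under the cup product (composition). Then for every G-module A and every i ∈ ℤ, the cup-product pairing induces an isomorphism of abelian groups Ĥ^i(G, Hom_ℤ(X, A)) ≅ Hom_{R'}(Ĥ^r(G, Hom_ℤ(X', X)), Ĥ^{i+r}(G, Hom_ℤ(X', A))), where both Ĥ^r(G, Hom_ℤ(X', X)) and Ĥ^{i+r}(G, Hom_ℤ(X', A)) are right R'-modules via the cup product and the isomorphism sends a class c to the map (c∪−). -/

import Mathlib

/-!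
This file sets up Tate cohomology of a finite group `G` (with coefficients in objects of
`Rep ℤ G`), realized concretely in each degree `n ∈ ℤ` as
`Ĥ^n(G, M) = Ĥ⁰(G, Hom_ℤ(J n, M))`, where `J n` is the standard `n`-th syzygy of the
trivial module `ℤ` (the `n`-th tensor power of the augmentation ideal `I_G` for `n ≥ 0`,
and of its `ℤ`-linear dual for `n < 0`), and `Ĥ⁰` denotes invariants modulo norms.
Cup products are induced by the canonical comparison maps `J (i+j) ⟶ J i ⊗ J j`.
-/

open CategoryTheory MonoidalCategory TensorProduct

set_option linter.unusedSectionVars false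
set_option maxHeartbeats 1000000

attribute [instance 0] AddCommGroup.toIntModule

namespace Enc

variable {k : Type} [CommRing k] {G : Type} [Group G] [Fintype G]

/-! ### Degree-zero Tate cohomology: invariants modulo norms -/

section Aux
variable {V V₂ : Type} [AddCommGroup V] [Module k V] [AddCommGroup V₂] [Module k V₂]

/-- The norm map `v ↦ ∑_{g ∈ G} g • v` of a representation. -/
noncomputable def rnorm (ρ : Representation k G V) : V →ₗ[k] V := ∑ g : G, ρ g

lemma rnorm_mem_invariants (ρ : Representation k G V) (v : V) :
    rnorm ρ v ∈ ρ.invariants := by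
  intro g
  show (ρ g) ((∑ h : G, ρ h) v) = _
  simp only [LinearMap.sum_apply, map_sum]
  rw [Fintype.sum_equiv (Equiv.mulLeft g) _ (fun h => ρ h v) (fun h => by
    rw [← Module.End.mul_apply, ← map_mul]; rfl)]
  simp [rnorm]

/-- The norm map, viewed as landing in the invariants. -/
noncomputable def rnormRes (ρ : Representation k G V) : V →ₗ[k] ρ.invariants :=
  (rnorm ρ).codRestrict ρ.invariants (rnorm_mem_invariants ρ)

/-- The image of the norm map, inside the invariants. -/
noncomputable def rnormIm (ρ : Representation k G V) : Submodule k ρ.invariants :=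
  LinearMap.range (rnormRes ρ)

/-- Degree-zero Tate cohomology of a representation: invariants modulo norms. -/
noncomputable def tate0 (ρ : Representation k G V) : Type :=
  ρ.invariants ⧸ rnormIm ρ

noncomputable instance (ρ : Representation k G V) : AddCommGroup (tate0 ρ) :=
  inferInstanceAs (AddCommGroup (ρ.invariants ⧸ rnormIm ρ))

noncomputable instance (ρ : Representation k G V) : Module k (tate0 ρ) :=
  inferInstanceAs (Module k (ρ.invariants ⧸ rnormIm ρ))

/-- The Tate class of an invariant vector. -/
noncomputable def tate0mk {ρ : Representation k G V} (v : V) (hv : v ∈ ρ.invariants) :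
    tate0 ρ := Submodule.Quotient.mk (⟨v, hv⟩ : ρ.invariants)

lemma invariants_comp {ρ : Representation k G V} {σ : Representation k G V₂}
    (f : V →ₗ[k] V₂) (hf : ∀ (g : G) (v : V), f (ρ g v) = σ g (f v)) :
    ∀ x ∈ ρ.invariants, f x ∈ σ.invariants := by
  intro x hx g
  rw [← hf g x, hx g]

/-- Functoriality of degree-zero Tate cohomology along equivariant maps. -/
noncomputable def tate0map {ρ : Representation k G V} {σ : Representation k G V₂}
    (f : V →ₗ[k] V₂) (hf : ∀ (g : G) (v : V), f (ρ g v) = σ g (f v)) :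
    tate0 ρ →ₗ[k] tate0 σ :=
  Submodule.mapQ (rnormIm ρ) (rnormIm σ) (f.restrict (invariants_comp f hf))
    (by
      rintro ⟨x, hx⟩ ⟨y, hy⟩
      refine ⟨f y, ?_⟩
      apply Subtype.ext
      have hy' := congrArg Subtype.val hy
      show rnorm σ (f y) = _
      simp only [LinearMap.restrict_apply]
      have : rnorm σ (f y) = f (rnorm ρ y) := by
        simp only [rnorm, LinearMap.sum_apply, map_sum]
        exact Finset.sum_congr rfl fun g _ => (hf g y).symm
      rw [this]
      exact congrArg f hy')

end Aux

/-- Degree-zero Tate cohomology `Ĥ⁰(G, W) = W^G / N_G W` of an object of `Rep k G`. -/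
noncomputable def H0T (W : Rep k G) : Type := tate0 W.ρ

noncomputable instance (W : Rep k G) : AddCommGroup (H0T W) :=
  inferInstanceAs (AddCommGroup (tate0 W.ρ))

noncomputable instance (W : Rep k G) : Module k (H0T W) :=
  inferInstanceAs (Module k (tate0 W.ρ))

/-- Functoriality of `Ĥ⁰` along morphisms of representations. -/
noncomputable def H0Tmap {W W' : Rep k G} (ψ : W ⟶ W') : H0T W →ₗ[k] H0T W' :=
  tate0map ψ.hom (fun g v => Rep.hom_comm_apply ψ g v)

/-! ### The augmentation ideal and the syzygy modules `J n` -/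

variable (G)

/-- The augmentation map `ℤ[G] → ℤ`. -/
noncomputable def aug : (G →₀ ℤ) →ₗ[ℤ] ℤ :=
  Finsupp.linearCombination ℤ (fun _ : G => (1 : ℤ))

lemma aug_comm (g : G) (x : G →₀ ℤ) :
    aug G (Finsupp.lmapDomain ℤ ℤ (fun h : G => g • h) x) = aug G x := by
  unfold aug
  simp [Finsupp.linearCombination_apply]
  rw [Finsupp.sum_mapDomain_index] <;> simp

/-- The underlying `ℤ`-module of the augmentation ideal. -/
noncomputable abbrev IGcar : Type := LinearMap.ker (aug G)

/-- The representation of `G` on the augmentation ideal. -/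
noncomputable def IGρ : Representation ℤ G (IGcar G) where
  toFun g := (Finsupp.lmapDomain ℤ ℤ (fun h : G => g • h)).restrict (p := LinearMap.ker (aug G))
    (q := LinearMap.ker (aug G)) (by
      intro x hx
      simp only [LinearMap.mem_ker] at hx ⊢
      rw [aug_comm]; exact hx)
  map_one' := by
    ext x
    simp [LinearMap.restrict_apply]
    exact DFunLike.congr_fun Finsupp.mapDomain_id _
  map_mul' g h := by ext x; simp [LinearMap.restrict_apply, Module.End.mul_apply,
    ← Finsupp.mapDomain_comp, Function.comp_def, mul_assoc]

/-- The augmentation ideal `I_G` of `ℤ[G]`, as an object of `Rep ℤ G`. -/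
noncomputable def IGrep : Rep ℤ G := Rep.of (IGρ G)

/-- `Hom_ℤ(X, A)` with the conjugation `G`-action, i.e. the internal hom in `Rep ℤ G`. -/
noncomputable abbrev hRep {G : Type} [Group G] (X A : Rep.{0} ℤ G) : Rep.{0} ℤ G :=
  (Rep.ihom X).obj A

/-- The `ℤ`-linear dual of the augmentation ideal, as an object of `Rep ℤ G`. -/
noncomputable def DIG : Rep ℤ G := hRep (IGrep G) (𝟙_ (Rep ℤ G))

instance : Module.Finite ℤ (IGcar G) := by
  have : Module.Finite ℤ (G →₀ ℤ) :=
    Module.Finite.equiv (Finsupp.linearEquivFunOnFinite ℤ ℤ G).symm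
  exact Module.Finite.of_injective (LinearMap.ker (aug G)).subtype Subtype.val_injective

instance : Module.Free ℤ (IGcar G) := by infer_instance

/-- Nonnegative tensor powers `I_G^{⊗ n}` (with `I_G^{⊗ 0} = ℤ`). -/
noncomputable def Jp : ℕ → Rep ℤ G
  | 0 => 𝟙_ (Rep ℤ G)
  | n + 1 => Jp n ⊗ IGrep G

/-- Tensor powers of the dual of the augmentation ideal. -/
noncomputable def Jn : ℕ → Rep ℤ G
  | 0 => 𝟙_ (Rep ℤ G)
  | n + 1 => Jn n ⊗ DIG G

/-- The standard syzygy modules of the trivial representation `ℤ`, indexed by `ℤ`: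
`J n = I_G^{⊗ n}` for `n ≥ 0`, and `J n = (I_G^∨)^{⊗ (-n)}` for `n < 0`. -/
noncomputable def J : ℤ → Rep ℤ G
  | .ofNat n => Jp G n
  | .negSucc n => Jn G (n + 1)

lemma J_ofNat (m : ℕ) : J G (m : ℤ) = Jp G m := rfl

lemma J_neg (m : ℕ) : J G (-(m : ℤ)) = Jn G m := by cases m <;> rfl

/-- The element of `(I_G)^∨ ⊗ I_G` corresponding to the identity map. -/
noncomputable def preElt : Module.Dual ℤ (IGcar G) ⊗[ℤ] IGcar G :=
  (dualTensorHomEquiv ℤ (IGcar G) (IGcar G)).symm LinearMap.id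

/-- The canonical element of `I_G ⊗ (I_G)^∨` corresponding to the identity map. -/
noncomputable def coevElt : (IGrep G ⊗ DIG G).V :=
  (TensorProduct.comm ℤ _ _) (preElt G)

lemma conj_dualTensor (g : G) (t : Module.Dual ℤ (IGcar G) ⊗[ℤ] IGcar G) :
    dualTensorHom ℤ _ _ (TensorProduct.map ((DIG G).ρ g) ((IGrep G).ρ g) t)
      = (IGrep G).ρ g ∘ₗ (dualTensorHom ℤ _ _ t) ∘ₗ (IGrep G).ρ g⁻¹ := by
  have aux : ∀ (a b : IGcar G →ₗ[ℤ] IGcar G)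
      (d : Module.Dual ℤ (IGcar G) →ₗ[ℤ] Module.Dual ℤ (IGcar G)) (_ : ∀ f, d f = f ∘ₗ b)
      (t : Module.Dual ℤ (IGcar G) ⊗[ℤ] IGcar G),
      dualTensorHom ℤ _ _ (TensorProduct.map d a t) = a ∘ₗ (dualTensorHom ℤ _ _ t) ∘ₗ b := by
    intro a b d hd t
    induction t with
    | zero => simp
    | tmul f v =>
        apply LinearMap.ext
        intro w
        simp only [TensorProduct.map_tmul, dualTensorHom_apply,
          LinearMap.comp_apply, map_smul, hd]
    | add x y hx hy =>
        simp only [map_add, hx, hy, LinearMap.add_comp, LinearMap.comp_add]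
  exact aux ((IGrep G).ρ g) ((IGrep G).ρ g⁻¹) ((DIG G).ρ g) (fun f => rfl) t

lemma coevElt_invariant (g : G) :
    ((IGrep G ⊗ DIG G).ρ g) (coevElt G) = coevElt G := by
  show TensorProduct.map ((IGrep G).ρ g) ((DIG G).ρ g)
      ((TensorProduct.comm ℤ _ _) (preElt G)) = _
  refine (TensorProduct.map_comm ((IGrep G).ρ g) ((DIG G).ρ g) (preElt G)).trans ?_
  show (TensorProduct.comm ℤ _ _) (TensorProduct.map ((DIG G).ρ g) ((IGrep G).ρ g) (preElt G))
      = (TensorProduct.comm ℤ _ _) (preElt G)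
  congr 1
  apply (dualTensorHomEquiv ℤ (IGcar G) (IGcar G)).injective
  have h2 : dualTensorHom ℤ (IGcar G) (IGcar G) (preElt G) = LinearMap.id :=
    (dualTensorHomEquiv ℤ (IGcar G) (IGcar G)).apply_symm_apply LinearMap.id
  show dualTensorHom ℤ (IGcar G) (IGcar G)
      (TensorProduct.map ((DIG G).ρ g) ((IGrep G).ρ g) (preElt G))
    = dualTensorHom ℤ (IGcar G) (IGcar G) (preElt G)
  refine (conj_dualTensor G g (preElt G)).trans ?_
  show (IGrep G).ρ g ∘ₗ dualTensorHom ℤ (IGcar G) (IGcar G) (preElt G) ∘ₗ (IGrep G).ρ g⁻¹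
      = dualTensorHom ℤ (IGcar G) (IGcar G) (preElt G)
  rw [h2]
  apply LinearMap.ext
  intro v
  exact (IGrep G).ρ.self_inv_apply g v

/-- The coevaluation `ℤ ⟶ I_G ⊗ I_G^∨`. -/
noncomputable def coev : 𝟙_ (Rep ℤ G) ⟶ IGrep G ⊗ DIG G := ConcreteCategory.ofHom (C := Rep ℤ G) {
  LinearMap.toSpanSingleton ℤ _ (coevElt G) with
  isIntertwining' := by
    intro g
    apply LinearMap.ext
    intro z
    show LinearMap.toSpanSingleton ℤ _ (coevElt G) ((𝟙_ (Rep ℤ G)).ρ g z)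
        = ((IGrep G ⊗ DIG G).ρ g) (LinearMap.toSpanSingleton ℤ _ (coevElt G) z)
    have hz : ((𝟙_ (Rep ℤ G)).ρ g z) = z := rfl
    rw [hz]
    show z • coevElt G = ((IGrep G ⊗ DIG G).ρ g) (z • coevElt G)
    rw [map_smul, coevElt_invariant] }


variable {G}

/-- One-step comparison `J (n+1) ⟶ J n ⊗ I_G`. -/
noncomputable def sMap : ∀ n : ℤ, J G (n + 1) ⟶ J G n ⊗ IGrep G
  | .ofNat m => 𝟙 (Jp G m ⊗ IGrep G)
  | .negSucc 0 =>
      coev G ≫ (β_ (IGrep G) (DIG G)).hom ≫ ((λ_ (DIG G)).inv ▷ IGrep G)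
  | .negSucc (m+1) =>
      (ρ_ (Jn G (m+1))).inv ≫ (Jn G (m+1) ◁ (coev G ≫ (β_ (IGrep G) (DIG G)).hom))
        ≫ (α_ (Jn G (m+1)) (DIG G) (IGrep G)).inv

/-- One-step comparison `J (n-1) ⟶ J n ⊗ I_G^∨`. -/
noncomputable def tMap : ∀ n : ℤ, J G (n - 1) ⟶ J G n ⊗ DIG G
  | .ofNat 0 => 𝟙 (𝟙_ (Rep ℤ G) ⊗ DIG G)
  | .ofNat (m+1) =>
      eqToHom (congrArg (J G) (show (Int.ofNat (m+1)) - 1 = ((m:ℕ) : ℤ) by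
        rw [Int.ofNat_eq_coe]; push_cast; ring)) ≫
      (ρ_ (Jp G m)).inv ≫ (Jp G m ◁ coev G) ≫ (α_ (Jp G m) (IGrep G) (DIG G)).inv
  | .negSucc m => eqToHom (show J G (Int.negSucc m - 1) = J G (Int.negSucc m) ⊗ DIG G from rfl)

/-- Comparison maps `J (i + m) ⟶ J i ⊗ J m` for `m ≥ 0`. -/
noncomputable def μpos (i : ℤ) : ∀ m : ℕ, J G (i + m) ⟶ J G i ⊗ J G (m : ℤ)
  | 0 => eqToHom (congrArg (J G) (by omega)) ≫ (ρ_ (J G i)).inv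
  | m + 1 =>
      eqToHom (congrArg (J G) (show i + ((m:ℕ)+1:ℕ) = (i + m) + 1 by omega))
        ≫ sMap (i + m) ≫ (μpos i m ▷ IGrep G) ≫ (α_ (J G i) (J G (m:ℤ)) (IGrep G)).hom

/-- Comparison maps `J (i - m) ⟶ J i ⊗ J (-m)` for `m ≥ 0`. -/
noncomputable def μneg (i : ℤ) : ∀ m : ℕ, J G (i - m) ⟶ J G i ⊗ J G (-(m : ℤ))
  | 0 => eqToHom (congrArg (J G) (by omega)) ≫ (ρ_ (J G i)).inv
  | m + 1 =>
      eqToHom (congrArg (J G) (show i - ((m:ℕ)+1:ℕ) = (i - m) - 1 by omega))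
        ≫ tMap (i - m) ≫ (μneg i m ▷ DIG G) ≫ (α_ (J G i) (J G (-(m:ℤ))) (DIG G)).hom
        ≫ (J G i ◁ (eqToHom (show J G (-(m:ℤ)) ⊗ DIG G = J G (-((m:ℕ)+1:ℕ)) by
            rw [J_neg, J_neg]; rfl)))

variable (G)

/-- The canonical comparison map `J (i+j) ⟶ J i ⊗ J j`, implementing the standard stable
equivalences between the syzygies `J`; it induces the cup product on Tate cohomology. -/
noncomputable def μ (i : ℤ) : ∀ j : ℤ, J G (i + j) ⟶ J G i ⊗ J G j
  | .ofNat m => μpos i m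
  | .negSucc m =>
      eqToHom (congrArg (J G) (show i + Int.negSucc m = i - ((m+1 : ℕ) : ℤ) by
        rw [Int.negSucc_eq]; push_cast; ring))
        ≫ μneg i (m+1)

variable {G}

/-! ### Tate cohomology in all degrees, functoriality, cup products -/

/-- Tate cohomology `Ĥ^n(G, M)` of the finite group `G` with coefficients in `M : Rep ℤ G`,
realized as `Ĥ⁰(G, Hom_ℤ(J n, M))` for the standard `n`-th syzygy `J n` of `ℤ`. -/
noncomputable def tate (n : ℤ) (M : Rep ℤ G) : Type := H0T (hRep (J G n) M)

noncomputable instance (n : ℤ) (M : Rep ℤ G) : AddCommGroup (tate n M) :=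
  inferInstanceAs (AddCommGroup (H0T (hRep (J G n) M)))

/-- The map on Tate cohomology induced by a morphism of representations. -/
noncomputable def tmap (n : ℤ) {M N : Rep ℤ G} (φ : M ⟶ N) : tate n M → tate n N :=
  H0Tmap ((Rep.ihom (J G n)).map φ)

/-- Transport of Tate cohomology along an equality of degrees. -/
noncomputable def tcast {i j : ℤ} {M : Rep ℤ G} (h : i = j) (z : tate i M) : tate j M :=
  h ▸ z

lemma hom_invariant {X W : Rep.{0} ℤ G} (m : X ⟶ W) :
    m.hom.toLinearMap ∈ (hRep X W).ρ.invariants := by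
  intro g
  show W.ρ g ∘ₗ m.hom.toLinearMap ∘ₗ X.ρ g⁻¹ = m.hom.toLinearMap
  ext v
  exact (congrArg (W.ρ g) (Rep.hom_comm_apply m g⁻¹ v)).trans (W.ρ.self_inv_apply g _)

/-- The Tate cohomology class of a `G`-equivariant map `J n ⟶ W`. -/
noncomputable def mkCls {n : ℤ} {W : Rep ℤ G} (m : J G n ⟶ W) : tate n W :=
  tate0mk m.hom.toLinearMap (hom_invariant m)


lemma tensor_rho_eq (M N : Rep ℤ G) (g : G) :
    (M ⊗ N).ρ g = TensorProduct.map (M.ρ g) (N.ρ g) := rfl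

lemma cup_invariance {i j : ℤ} {M N : Rep ℤ G}
    (f : ((hRep (J G i) M).ρ.invariants))
    (g : ((hRep (J G j) N).ρ.invariants)) :
    (TensorProduct.map f.1 g.1).comp ((μ G i j).hom.toLinearMap)
      ∈ (hRep (J G (i + j)) (M ⊗ N)).ρ.invariants := by
  intro gg
  have hf : M.ρ gg ∘ₗ f.1 ∘ₗ (J G i).ρ gg⁻¹ = f.1 := f.2 gg
  have hg : N.ρ gg ∘ₗ g.1 ∘ₗ (J G j).ρ gg⁻¹ = g.1 := g.2 gg
  have hμ : (μ G i j).hom.toLinearMap.comp ((J G (i + j)).ρ gg⁻¹)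
      = (TensorProduct.map ((J G i).ρ gg⁻¹) ((J G j).ρ gg⁻¹)).comp (μ G i j).hom.toLinearMap := by
    have h := (μ G i j).hom.isIntertwining' gg⁻¹
    exact h
  have key : ∀ (f : (J G i).V →ₗ[ℤ] M.V) (g : (J G j).V →ₗ[ℤ] N.V),
      M.ρ gg ∘ₗ f ∘ₗ (J G i).ρ gg⁻¹ = f → N.ρ gg ∘ₗ g ∘ₗ (J G j).ρ gg⁻¹ = g →
      (M ⊗ N).ρ gg ∘ₗ ((TensorProduct.map f g).comp (μ G i j).hom.toLinearMap)
        ∘ₗ (J G (i + j)).ρ gg⁻¹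
      = (TensorProduct.map f g).comp (μ G i j).hom.toLinearMap := by
    intro f g hf hg
    rw [LinearMap.comp_assoc, hμ, tensor_rho_eq, ← LinearMap.comp_assoc,
      ← LinearMap.comp_assoc, ← TensorProduct.map_comp, ← TensorProduct.map_comp]
    rw [LinearMap.comp_assoc (((J G i)).ρ gg⁻¹) f (M.ρ gg),
      LinearMap.comp_assoc (((J G j)).ρ gg⁻¹) g (N.ρ gg), hf, hg]
  exact key f.1 g.1 hf hg

lemma conj_term {i j : ℤ} {M N : Rep ℤ G} (u : (J G i).V →ₗ[ℤ] M.V)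
    (w : (J G j).V →ₗ[ℤ] N.V) (h : G) :
    (TensorProduct.map (M.ρ h ∘ₗ u ∘ₗ (J G i).ρ h⁻¹) (N.ρ h ∘ₗ w ∘ₗ (J G j).ρ h⁻¹)).comp
        (μ G i j).hom.toLinearMap
      = ((hRep (J G (i + j)) (M ⊗ N)).ρ h) ((TensorProduct.map u w).comp (μ G i j).hom.toLinearMap) := by
  have hμ : (μ G i j).hom.toLinearMap ∘ₗ (J G (i + j)).ρ h⁻¹
      = TensorProduct.map ((J G i).ρ h⁻¹) ((J G j).ρ h⁻¹) ∘ₗ (μ G i j).hom.toLinearMap := by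
    have hc := (μ G i j).hom.isIntertwining' h⁻¹
    exact hc
  show _ = (M ⊗ N).ρ h ∘ₗ ((TensorProduct.map u w).comp (μ G i j).hom.toLinearMap) ∘ₗ (J G (i + j)).ρ h⁻¹
  rw [LinearMap.comp_assoc, hμ, ← LinearMap.comp_assoc, ← LinearMap.comp_assoc]
  rw [TensorProduct.map_comp, TensorProduct.map_comp]
  rfl

lemma cup_norm_left {i j : ℤ} {M N : Rep ℤ G} (u : (J G i).V →ₗ[ℤ] M.V)
    (g : ((hRep (J G j) N).ρ.invariants)) :
    (TensorProduct.map (rnorm ((hRep (J G i) M).ρ) u) g.1).comp (μ G i j).hom.toLinearMap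
      = rnorm ((hRep (J G (i + j)) (M ⊗ N)).ρ)
          ((TensorProduct.map u g.1).comp (μ G i j).hom.toLinearMap) := by
  have h1 : rnorm ((hRep (J G i) M).ρ) u = ∑ h : G, ((hRep (J G i) M).ρ h) u := by
    exact LinearMap.sum_apply _ _ _
  have h2 : rnorm ((hRep (J G (i + j)) (M ⊗ N)).ρ) ((TensorProduct.map u g.1).comp (μ G i j).hom.toLinearMap)
      = ∑ h : G, ((hRep (J G (i + j)) (M ⊗ N)).ρ h)
          ((TensorProduct.map u g.1).comp (μ G i j).hom.toLinearMap) := by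
    exact LinearMap.sum_apply _ _ _
  rw [h1, h2]
  let g' : (J G j).V →ₗ[ℤ] N.V := g.1
  let Φ : ((J G i).V →ₗ[ℤ] M.V) →+ ((J G (i + j)).V →ₗ[ℤ] (M ⊗ N).V) :=
    AddMonoidHom.mk' (fun a => (TensorProduct.map a g').comp (μ G i j).hom.toLinearMap)
      (fun a b => by rw [TensorProduct.map_add_left, LinearMap.add_comp])
  refine (map_sum Φ (fun h => ((hRep (J G i) M).ρ h) u) Finset.univ).trans
    (Finset.sum_congr rfl fun h _ => ?_)
  have hginv : N.ρ h ∘ₗ g.1 ∘ₗ (J G j).ρ h⁻¹ = g.1 := g.2 h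
  refine Eq.trans ?_ (conj_term u g.1 h)
  exact congrArg (fun t => (TensorProduct.map (M.ρ h ∘ₗ u ∘ₗ (J G i).ρ h⁻¹) t).comp
    (μ G i j).hom.toLinearMap) hginv.symm

lemma cup_norm_right {i j : ℤ} {M N : Rep ℤ G}
    (f : ((hRep (J G i) M).ρ.invariants)) (w : (J G j).V →ₗ[ℤ] N.V) :
    (TensorProduct.map f.1 (rnorm ((hRep (J G j) N).ρ) w)).comp (μ G i j).hom.toLinearMap
      = rnorm ((hRep (J G (i + j)) (M ⊗ N)).ρ)
          ((TensorProduct.map f.1 w).comp (μ G i j).hom.toLinearMap) := by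
  have h1 : rnorm ((hRep (J G j) N).ρ) w = ∑ h : G, ((hRep (J G j) N).ρ h) w := by
    exact LinearMap.sum_apply _ _ _
  have h2 : rnorm ((hRep (J G (i + j)) (M ⊗ N)).ρ) ((TensorProduct.map f.1 w).comp (μ G i j).hom.toLinearMap)
      = ∑ h : G, ((hRep (J G (i + j)) (M ⊗ N)).ρ h)
          ((TensorProduct.map f.1 w).comp (μ G i j).hom.toLinearMap) := by
    exact LinearMap.sum_apply _ _ _
  rw [h1, h2]
  let f' : (J G i).V →ₗ[ℤ] M.V := f.1
  let Φ : ((J G j).V →ₗ[ℤ] N.V) →+ ((J G (i + j)).V →ₗ[ℤ] (M ⊗ N).V) :=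
    AddMonoidHom.mk' (fun a => (TensorProduct.map f' a).comp (μ G i j).hom.toLinearMap)
      (fun a b => by rw [TensorProduct.map_add_right, LinearMap.add_comp])
  refine (map_sum Φ (fun h => ((hRep (J G j) N).ρ h) w) Finset.univ).trans
    (Finset.sum_congr rfl fun h _ => ?_)
  have hfinv : M.ρ h ∘ₗ f.1 ∘ₗ (J G i).ρ h⁻¹ = f.1 := f.2 h
  refine Eq.trans ?_ (conj_term f.1 w h)
  exact congrArg (fun t => (TensorProduct.map t (N.ρ h ∘ₗ w ∘ₗ (J G j).ρ h⁻¹)).comp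
    (μ G i j).hom.toLinearMap) hfinv.symm

lemma cup_welldef {i j : ℤ} {M N : Rep ℤ G}
    (a₁ : ((hRep (J G i) M).ρ.invariants)) (b₁ : ((hRep (J G j) N).ρ.invariants))
    (a₂ : ((hRep (J G i) M).ρ.invariants)) (b₂ : ((hRep (J G j) N).ρ.invariants))
    (ha : a₁ - a₂ ∈ rnormIm ((hRep (J G i) M).ρ))
    (hb : b₁ - b₂ ∈ rnormIm ((hRep (J G j) N).ρ)) :
    tate0mk (ρ := (hRep (J G (i + j)) (M ⊗ N)).ρ)
          ((TensorProduct.map a₁.1 b₁.1).comp ((μ G i j).hom.toLinearMap)) (cup_invariance a₁ b₁)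
      = tate0mk (ρ := (hRep (J G (i + j)) (M ⊗ N)).ρ)
          ((TensorProduct.map a₂.1 b₂.1).comp ((μ G i j).hom.toLinearMap)) (cup_invariance a₂ b₂) := by
  obtain ⟨u, hu⟩ := ha
  obtain ⟨w, hw⟩ := hb
  have hu' : rnorm ((hRep (J G i) M).ρ) u = a₁.1 - a₂.1 := congrArg Subtype.val hu
  have hw' : rnorm ((hRep (J G j) N).ρ) w = b₁.1 - b₂.1 := congrArg Subtype.val hw
  have step1 : tate0mk (ρ := (hRep (J G (i + j)) (M ⊗ N)).ρ)
          ((TensorProduct.map a₁.1 b₁.1).comp ((μ G i j).hom.toLinearMap))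
        (cup_invariance a₁ b₁)
      = tate0mk (ρ := (hRep (J G (i + j)) (M ⊗ N)).ρ)
          ((TensorProduct.map a₂.1 b₁.1).comp ((μ G i j).hom.toLinearMap)) (cup_invariance a₂ b₁) := by
    refine (Submodule.Quotient.eq _).2 ?_
    refine ⟨(TensorProduct.map u b₁.1).comp ((μ G i j).hom.toLinearMap), ?_⟩
    apply Subtype.ext
    have key := cup_norm_left u b₁
    refine key.symm.trans ?_
    refine (congrArg (fun t => (TensorProduct.map t b₁.1).comp (μ G i j).hom.toLinearMap) hu').trans ?_
    let c : (J G j).V →ₗ[ℤ] N.V := b₁.1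
    let Φ : ((J G i).V →ₗ[ℤ] M.V) →+ ((J G (i + j)).V →ₗ[ℤ] (M ⊗ N).V) :=
      AddMonoidHom.mk' (fun t => (TensorProduct.map t c).comp (μ G i j).hom.toLinearMap)
        (fun a b => by rw [TensorProduct.map_add_left, LinearMap.add_comp])
    exact map_sub Φ a₁.1 a₂.1
  have step2 : tate0mk (ρ := (hRep (J G (i + j)) (M ⊗ N)).ρ)
          ((TensorProduct.map a₂.1 b₁.1).comp ((μ G i j).hom.toLinearMap))
        (cup_invariance a₂ b₁)
      = tate0mk (ρ := (hRep (J G (i + j)) (M ⊗ N)).ρ)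
          ((TensorProduct.map a₂.1 b₂.1).comp ((μ G i j).hom.toLinearMap)) (cup_invariance a₂ b₂) := by
    refine (Submodule.Quotient.eq _).2 ?_
    refine ⟨(TensorProduct.map a₂.1 w).comp ((μ G i j).hom.toLinearMap), ?_⟩
    apply Subtype.ext
    have key := cup_norm_right a₂ w
    refine key.symm.trans ?_
    refine (congrArg (fun t => (TensorProduct.map a₂.1 t).comp (μ G i j).hom.toLinearMap) hw').trans ?_
    let c : (J G i).V →ₗ[ℤ] M.V := a₂.1
    let Φ : ((J G j).V →ₗ[ℤ] N.V) →+ ((J G (i + j)).V →ₗ[ℤ] (M ⊗ N).V) :=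
      AddMonoidHom.mk' (fun t => (TensorProduct.map c t).comp (μ G i j).hom.toLinearMap)
        (fun a b => by rw [TensorProduct.map_add_right, LinearMap.add_comp])
    exact map_sub Φ b₁.1 b₂.1
  exact step1.trans step2

/-- The cup product `Ĥ^i(G, M) × Ĥ^j(G, N) → Ĥ^{i+j}(G, M ⊗ N)` on Tate cohomology,
induced by the comparison maps `μ`. -/
noncomputable def cup {i j : ℤ} {M N : Rep ℤ G} (z₁ : tate i M) (z₂ : tate j N) :
    tate (i + j) (M ⊗ N) :=
  Quotient.liftOn₂ z₁ z₂
    (fun f g => tate0mk ((TensorProduct.map f.1 g.1).comp ((μ G i j).hom.toLinearMap)) (cup_invariance f g))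
    (fun a₁ b₁ a₂ b₂ ha hb => cup_welldef a₁ b₁ a₂ b₂
      ((Submodule.quotientRel_def _).mp ha) ((Submodule.quotientRel_def _).mp hb))

/-! ### Pairings -/

/-- The composition pairing `Hom_ℤ(B, C) ⊗ Hom_ℤ(A, B) ⟶ Hom_ℤ(A, C)`, `f ⊗ φ ↦ f ∘ φ`. -/
noncomputable def compPair (A B C : Rep ℤ G) : hRep B C ⊗ hRep A B ⟶ hRep A C :=
  MonoidalClosed.curry <|
    (A ◁ (β_ (hRep B C) (hRep A B)).hom) ≫ (α_ A (hRep A B) (hRep B C)).inv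
      ≫ (((ihom.ev A).app B) ▷ hRep B C) ≫ (ihom.ev B).app C

/-- The evaluation pairing `Hom_ℤ(X, B) ⊗ X ⟶ B`, `f ⊗ x ↦ f x`. -/
noncomputable def evPair (X B : Rep ℤ G) : hRep X B ⊗ X ⟶ B :=
  (β_ (hRep X B) X).hom ≫ (ihom.ev X).app B

/-- The cup product `Ĥ^i(G, Hom(X, A)) × Ĥ^j(G, Hom(X', X)) → Ĥ^{i+j}(G, Hom(X', A))`
induced by the composition pairing. -/
noncomputable def ccup {i j : ℤ} {X X' A : Rep ℤ G}
    (z : tate i (hRep X A)) (x : tate j (hRep X' X)) : tate (i + j) (hRep X' A) :=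
  tmap (i + j) (compPair X' X A) (cup z x)

/-- `ccup`, with the degree of the target adjusted along an equality of integers. -/
noncomputable def ccupTo {i j m : ℤ} {X X' A : Rep ℤ G}
    (z : tate i (hRep X A)) (x : tate j (hRep X' X)) (h : i + j = m) :
    tate m (hRep X' A) :=
  tcast h (ccup z x)

/-- The class of the identity in `Ĥ⁰(G, Hom_ℤ(X, X))`. -/
noncomputable def idCls (X : Rep ℤ G) : tate 0 (hRep X X) :=
  mkCls (MonoidalClosed.curry (ρ_ X).hom)

/-! ### Encoding pairs and related notions -/

/-- `(X, X')` is an *`r`-encoding pair* if for some `i ∈ ℤ` there is a natural isomorphism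
of functors `Ĥ^i(G, Hom_ℤ(X, -)) ≅ Ĥ^{i+r}(G, Hom_ℤ(X', -))` on `Rep ℤ G`. -/
def IsEncodingPair {G : Type} [Group G] [Fintype G] (r : ℤ) (X X' : Rep ℤ G) : Prop :=
  ∃ (i : ℤ) (e : ∀ A : Rep ℤ G, tate i (hRep X A) ≃+ tate (i + r) (hRep X' A)),
    ∀ {A B : Rep ℤ G} (φ : A ⟶ B) (z : tate i (hRep X A)),
      e B (tmap i ((Rep.ihom X).map φ) z) = tmap (i + r) ((Rep.ihom X').map φ) (e A z)

/-- `x ∈ Ĥ^r(G, Hom_ℤ(X', X))` is an *encoding element* for the pair `(X, X')` if it has a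
*decoding element* `x' ∈ Ĥ^{-r}(G, Hom_ℤ(X, X'))` with `x' ∪ x = [id_{X'}]` and
`x ∪ x' = [id_X]`. -/
def IsEncodingElement {G : Type} [Group G] [Fintype G] {r : ℤ} (X X' : Rep ℤ G)
    (x : tate r (hRep X' X)) : Prop :=
  ∃ x' : tate (-r) (hRep X X'),
    ccupTo x' x (by ring) = idCls X' ∧ ccupTo x x' (by ring) = idCls X

/-- The induced `G`-module `ℤ[G] ⊗_ℤ A ≅ (G →₀ A)`, with `G` acting by left translation. -/
noncomputable def indRep (G : Type) [Group G] (A : Type) [AddCommGroup A] [Module ℤ A] :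
    Rep ℤ G :=
  Rep.of (G := G) (X := G →₀ A)
    { toFun := fun g => Finsupp.lmapDomain A ℤ (fun h => g * h)
      map_one' := by
        ext x h
        simp [Finsupp.lmapDomain_apply, Finsupp.mapDomain_id, one_mul]
      map_mul' := fun g g' => by
        ext x h
        simp [Finsupp.lmapDomain_apply, Module.End.mul_apply, Finsupp.mapDomain_single,
          mul_assoc] }

/-- A `G`-module is *induced* if it is isomorphic to `ℤ[G] ⊗_ℤ A` for some abelian group `A`. -/
def IsInduced {G : Type} [Group G] (M : Rep ℤ G) : Prop :=
  ∃ (A : Type) (_ : AddCommGroup A) (_ : Module ℤ A), Nonempty (M ≅ indRep G A)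

/-- A class `φ ∈ Ĥ⁰(G, Hom_ℤ(X, X))` is a unit for the (composition) cup product. -/
def IsUnitCls {G : Type} [Group G] [Fintype G] {X : Rep ℤ G}
    (φ : tate 0 (hRep X X)) : Prop :=
  ∃ ψ : tate 0 (hRep X X),
    ccupTo φ ψ (by ring) = idCls X ∧ ccupTo ψ φ (by ring) = idCls X


/-- The natural map `Hom_ℤ(X, A) ⊗ I_G ⟶ Hom_ℤ(X, A ⊗ I_G)`, `f ⊗ z ↦ (x ↦ f x ⊗ z)`. -/
noncomputable def pr0 (X A : Rep ℤ G) : hRep X A ⊗ IGrep G ⟶ hRep X (A ⊗ IGrep G) :=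
  MonoidalClosed.curry ((α_ X (hRep X A) (IGrep G)).inv ≫ ((ihom.ev X).app A ▷ IGrep G))

/-- The natural evaluation map `Hom_ℤ(X, Hom_ℤ(I_G, A)) ⊗ I_G ⟶ Hom_ℤ(X, A)`,
`f ⊗ z ↦ (x ↦ f x z)`. -/
noncomputable def pr1 (X A : Rep ℤ G) :
    hRep X (hRep (IGrep G) A) ⊗ IGrep G ⟶ hRep X A :=
  MonoidalClosed.curry ((α_ X (hRep X (hRep (IGrep G) A)) (IGrep G)).inv
    ≫ ((ihom.ev X).app (hRep (IGrep G) A) ▷ IGrep G) ≫ evPair (IGrep G) A)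

/-- The natural evaluation map `Hom_ℤ(X', X) ⊗ (X' ⊗ A) ⟶ X ⊗ A`. -/
noncomputable def tPair (X' X A : Rep ℤ G) : hRep X' X ⊗ (X' ⊗ A) ⟶ X ⊗ A :=
  (α_ (hRep X' X) X' A).inv ≫ (evPair X' X ▷ A)

/-- A functor `Rep ℤ G ⥤ Rep ℤ G` sends `ℤ`-split short exact sequences of `G`-modules to
short exact sequences of `G`-modules. -/
def PreservesZSplitSES {G : Type} [Group G] (F : Rep.{0} ℤ G ⥤ Rep.{0} ℤ G) : Prop :=
  ∀ (A B C : Rep ℤ G) (f : A ⟶ B) (g : B ⟶ C),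
    Function.Injective f.hom → Function.Surjective g.hom → Function.Exact f.hom g.hom →
    (∃ s : C.V →+ B.V, ∀ x, g.hom (s x) = x) →
    Function.Injective (F.map f).hom ∧ Function.Surjective (F.map g).hom ∧
      Function.Exact (F.map f).hom (F.map g).hom

/-- A *shiftable functor*: it sends `ℤ`-split short exact sequences of `G`-modules to short
exact sequences, and sends induced modules to induced modules. -/
def Shiftable {G : Type} [Group G] (F : Rep ℤ G ⥤ Rep ℤ G) : Prop :=
  PreservesZSplitSES F ∧ ∀ M : Rep ℤ G, IsInduced M → IsInduced (F.obj M)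

end Enc

namespace Enc

section Stable
variable {G : Type} [Group G] [Fintype G]

/-- Morphisms that are norms of `ℤ`-linear maps. -/
def IsNm {A B : Rep.{0} ℤ G} (f : A ⟶ B) : Prop :=
  ∃ u : A.V →ₗ[ℤ] B.V, ∀ x : A.V, f.hom x = ∑ g : G, B.ρ g (u (A.ρ g⁻¹ x))

lemma IsNm.add {A B : Rep.{0} ℤ G} {f f' : A ⟶ B} (h : IsNm f) (h' : IsNm f') :
    IsNm (f + f') := by
  obtain ⟨u, hu⟩ := h
  obtain ⟨v, hv⟩ := h'
  refine ⟨u + v, fun x => ?_⟩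
  have : (f + f').hom x = f.hom x + f'.hom x := rfl
  rw [this, hu, hv, ← Finset.sum_add_distrib]
  simp

lemma IsNm.neg {A B : Rep.{0} ℤ G} {f : A ⟶ B} (h : IsNm f) : IsNm (-f) := by
  obtain ⟨u, hu⟩ := h
  refine ⟨-u, fun x => ?_⟩
  have : (-f).hom x = - f.hom x := rfl
  rw [this, hu, ← Finset.sum_neg_distrib]
  simp

lemma isNm_zero {A B : Rep.{0} ℤ G} : IsNm (0 : A ⟶ B) := by
  refine ⟨0, fun x => ?_⟩
  have : (0 : A ⟶ B).hom x = 0 := rfl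
  rw [this]; simp

lemma IsNm.comp {A B C : Rep.{0} ℤ G} {f : A ⟶ B} (h : IsNm f) (k : B ⟶ C) :
    IsNm (f ≫ k) := by
  obtain ⟨u, hu⟩ := h
  refine ⟨k.hom.toLinearMap ∘ₗ u, fun x => ?_⟩
  have : (f ≫ k).hom x = k.hom (f.hom x) := rfl
  rw [this, hu, map_sum]
  exact Finset.sum_congr rfl fun g _ => Rep.hom_comm_apply k g _

lemma IsNm.precomp {A B C : Rep.{0} ℤ G} {f : B ⟶ C} (h : IsNm f) (k : A ⟶ B) :
    IsNm (k ≫ f) := by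
  obtain ⟨u, hu⟩ := h
  refine ⟨u ∘ₗ k.hom.toLinearMap, fun x => ?_⟩
  have : (k ≫ f).hom x = f.hom (k.hom x) := rfl
  rw [this, hu]
  refine Finset.sum_congr rfl fun g _ => ?_
  rw [← Rep.hom_comm_apply k g⁻¹ x]; rfl

lemma IsNm.whiskerRight {A B : Rep.{0} ℤ G} {f : A ⟶ B} (h : IsNm f) (C : Rep.{0} ℤ G) :
    IsNm (f ▷ C) := by
  obtain ⟨u, hu⟩ := h
  refine ⟨LinearMap.rTensor C.V u, fun x => ?_⟩
  change LinearMap.rTensor C.V f.hom.toLinearMap x = ∑ g : G, TensorProduct.map (B.ρ g) (C.ρ g)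
    (LinearMap.rTensor C.V u (TensorProduct.map (A.ρ g⁻¹) (C.ρ g⁻¹) x))
  change A.V ⊗[ℤ] C.V at x
  induction x with
  | zero => simp
  | add x y hx hy => simp only [map_add, hx, hy, Finset.sum_add_distrib]
  | tmul a c =>
    simp only [LinearMap.rTensor_tmul, TensorProduct.map_tmul, Representation.self_inv_apply]
    rw [← TensorProduct.sum_tmul]
    exact congrArg (· ⊗ₜ[ℤ] c) (hu a)

lemma IsNm.whiskerLeft {A B : Rep.{0} ℤ G} {f : A ⟶ B} (h : IsNm f) (C : Rep.{0} ℤ G) :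
    IsNm (C ◁ f) := by
  have : C ◁ f = (β_ C A).hom ≫ f ▷ C ≫ (β_ B C).hom := by
    rw [← BraidedCategory.braiding_naturality_right_assoc]; simp
  rw [this]
  exact ((h.whiskerRight C).comp _).precomp _

/-- Stable equality of morphisms. -/
def StEq {A B : Rep.{0} ℤ G} (f f' : A ⟶ B) : Prop := IsNm (f - f')

lemma StEq.refl {A B : Rep.{0} ℤ G} (f : A ⟶ B) : StEq f f := by
  unfold StEq; rw [sub_self]; exact isNm_zero

lemma StEq.of_eq {A B : Rep.{0} ℤ G} {f f' : A ⟶ B} (h : f = f') : StEq f f' := by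
  subst h; exact StEq.refl f

lemma StEq.symm {A B : Rep.{0} ℤ G} {f f' : A ⟶ B} (h : StEq f f') : StEq f' f := by
  unfold StEq; rw [← neg_sub]; exact h.neg

lemma StEq.trans {A B : Rep.{0} ℤ G} {f f' f'' : A ⟶ B} (h : StEq f f') (h' : StEq f' f'') :
    StEq f f'' := by
  unfold StEq; rw [← sub_add_sub_cancel f f' f'']; exact IsNm.add h h'

lemma StEq.comp {A B C : Rep.{0} ℤ G} {f f' : A ⟶ B} (h : StEq f f') (k : B ⟶ C) :
    StEq (f ≫ k) (f' ≫ k) := by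
  unfold StEq; rw [← Preadditive.sub_comp]; exact IsNm.comp h k

lemma StEq.precomp {A B C : Rep.{0} ℤ G} {f f' : B ⟶ C} (h : StEq f f') (k : A ⟶ B) :
    StEq (k ≫ f) (k ≫ f') := by
  unfold StEq; rw [← Preadditive.comp_sub]; exact IsNm.precomp h k

lemma StEq.whiskerRight {A B : Rep.{0} ℤ G} {f f' : A ⟶ B} (h : StEq f f') (C : Rep.{0} ℤ G) :
    StEq (f ▷ C) (f' ▷ C) := by
  have : f ▷ C - f' ▷ C = (f - f') ▷ C := ((tensoringRight (Rep.{0} ℤ G)).obj C).map_sub.symm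
  unfold StEq; rw [this]; exact IsNm.whiskerRight h C

lemma StEq.whiskerLeft {A B : Rep.{0} ℤ G} {f f' : A ⟶ B} (h : StEq f f') (C : Rep.{0} ℤ G) :
    StEq (C ◁ f) (C ◁ f') := by
  have : C ◁ f - C ◁ f' = C ◁ (f - f') := ((tensoringLeft (Rep.{0} ℤ G)).obj C).map_sub.symm
  unfold StEq; rw [this]; exact IsNm.whiskerLeft h C

/-- Stable isomorphisms. -/
def StIso {A B : Rep.{0} ℤ G} (f : A ⟶ B) : Prop :=
  ∃ k : B ⟶ A, StEq (f ≫ k) (𝟙 A) ∧ StEq (k ≫ f) (𝟙 B)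

lemma StIso.of_isIso {A B : Rep.{0} ℤ G} (f : A ⟶ B) [IsIso f] : StIso f :=
  ⟨inv f, StEq.of_eq (by simp), StEq.of_eq (by simp)⟩

lemma StIso.comp {A B C : Rep.{0} ℤ G} {f : A ⟶ B} {f' : B ⟶ C} (h : StIso f) (h' : StIso f') :
    StIso (f ≫ f') := by
  obtain ⟨k, h1, h2⟩ := h
  obtain ⟨k', h1', h2'⟩ := h'
  refine ⟨k' ≫ k, ?_, ?_⟩
  · have := ((h1'.precomp f).comp k)
    simp only [Category.comp_id, Category.assoc] at this ⊢
    exact this.trans h1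
  · have := ((h2.precomp k').comp f')
    simp only [Category.comp_id, Category.assoc] at this ⊢
    exact this.trans h2'

lemma StIso.whiskerRight {A B : Rep.{0} ℤ G} {f : A ⟶ B} (h : StIso f) (C : Rep.{0} ℤ G) :
    StIso (f ▷ C) := by
  obtain ⟨k, h1, h2⟩ := h
  refine ⟨k ▷ C, ?_, ?_⟩
  · simpa using h1.whiskerRight C
  · simpa using h2.whiskerRight C

lemma StIso.whiskerLeft {A B : Rep.{0} ℤ G} {f : A ⟶ B} (h : StIso f) (C : Rep.{0} ℤ G) :
    StIso (C ◁ f) := by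
  obtain ⟨k, h1, h2⟩ := h
  refine ⟨C ◁ k, ?_, ?_⟩
  · simpa using h1.whiskerLeft C
  · simpa using h2.whiskerLeft C

lemma StIso.cancel_left {A B C : Rep.{0} ℤ G} {f : A ⟶ B} (h : StIso f) {a b : B ⟶ C}
    (hab : StEq (f ≫ a) (f ≫ b)) : StEq a b := by
  obtain ⟨k, h1, h2⟩ := h
  have e := hab.precomp k
  rw [← Category.assoc, ← Category.assoc] at e
  have e1 := h2.comp a
  have e2 := h2.comp b
  rw [Category.id_comp] at e1 e2
  exact e1.symm.trans (e.trans e2)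

lemma StIso.cancel_right {A B C : Rep.{0} ℤ G} {f : B ⟶ C} (h : StIso f) {a b : A ⟶ B}
    (hab : StEq (a ≫ f) (b ≫ f)) : StEq a b := by
  obtain ⟨k, h1, h2⟩ := h
  have e := hab.comp k
  rw [Category.assoc, Category.assoc] at e
  have e1 := h1.precomp a
  have e2 := h1.precomp b
  rw [Category.comp_id] at e1 e2
  exact e1.symm.trans (e.trans e2)

end Stable
end Enc

namespace Enc

section Coev
variable (G : Type) [Group G] [Fintype G]

/-- The element `k - l` of the augmentation ideal. -/
noncomputable def bb (k l : G) : IGcar G :=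
  ⟨Finsupp.single k 1 - Finsupp.single l 1, by simp [aug]⟩

/-- The coordinate functions on the augmentation ideal. -/
noncomputable def cc (k : G) : IGcar G →ₗ[ℤ] ℤ :=
  Finsupp.lapply k ∘ₗ (LinearMap.ker (aug G)).subtype

lemma cc_bb (h k l : G) [DecidableEq G] : cc G h (bb G k l) =
    (if k = h then 1 else 0) - (if l = h then 1 else 0) := by
  simp [cc, bb, Finsupp.single_apply]

lemma sum_cc (x : IGcar G) : ∑ g : G, cc G g x = 0 := by
  have := x.2
  rw [LinearMap.mem_ker] at this
  unfold aug at this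
  rw [Finsupp.linearCombination_apply, Finsupp.sum_fintype] at this
  · simpa [cc] using this
  · simp

lemma ext_cc {x y : IGcar G} (h : ∀ g, cc G g x = cc G g y) : x = y :=
  Subtype.ext (Finsupp.ext h)

lemma sum_bb_right (x : IGcar G) (h : G) : ∑ g : G, cc G g x • bb G g h = x := by
  classical
  apply ext_cc
  intro k
  simp only [map_sum, map_smul, cc_bb, smul_eq_mul, mul_sub, Finset.sum_sub_distrib,
    ← Finset.sum_mul, sum_cc]
  simp

lemma bb_neg (k l : G) : bb G k l = - bb G l k := by
  apply Subtype.ext; simp [bb]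

lemma sum_bb_left (x : IGcar G) (h : G) : ∑ g : G, cc G g x • bb G h g = - x := by
  conv_rhs => rw [← sum_bb_right G x h]
  rw [← Finset.sum_neg_distrib]
  refine Finset.sum_congr rfl fun g _ => ?_
  rw [bb_neg, smul_neg]

lemma rho_bb (g k l : G) : IGρ G g (bb G k l) = bb G (g * k) (g * l) := by
  apply Subtype.ext
  simp [bb, IGρ, LinearMap.restrict_apply, Finsupp.mapDomain_single, Finsupp.mapDomain_sub]

lemma cc_rho (g k : G) (x : IGcar G) : cc G k (IGρ G g x) = cc G (g⁻¹ * k) x := by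
  have : k = g * (g⁻¹ * k) := by group
  change (Finsupp.mapDomain (fun h : G => g • h) x.1) k = x.1 (g⁻¹ * k)
  conv_lhs => rw [this]
  exact Finsupp.mapDomain_apply (mul_right_injective g) _ _

/-- Preimage of `-(id + coev ev)` under the norm. -/
noncomputable def psi : IGcar G ⊗[ℤ] (IGcar G →ₗ[ℤ] ℤ) →ₗ[ℤ] IGcar G ⊗[ℤ] (IGcar G →ₗ[ℤ] ℤ) :=
  TensorProduct.lift (LinearMap.mk₂ ℤ
    (fun x φ => ∑ k : G, (cc G 1 x * φ (bb G k 1)) • (bb G k 1 ⊗ₜ[ℤ] cc G k))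
    (fun x y φ => by simp [add_mul, add_smul, Finset.sum_add_distrib])
    (fun c x φ => by simp [mul_assoc, mul_smul, Finset.smul_sum])
    (fun x φ χ => by simp [mul_add, add_smul, Finset.sum_add_distrib])
    (fun c x φ => by simp [mul_left_comm, mul_smul, Finset.smul_sum]))

/-- `I ⊗ I^∨ ≃ End I`. -/
noncomputable def TT : IGcar G ⊗[ℤ] (IGcar G →ₗ[ℤ] ℤ) ≃ₗ[ℤ] (IGcar G →ₗ[ℤ] IGcar G) :=
  (TensorProduct.comm ℤ _ _) ≪≫ₗ dualTensorHomEquiv ℤ (IGcar G) (IGcar G)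

lemma TT_tmul (x z : IGcar G) (φ : IGcar G →ₗ[ℤ] ℤ) : TT G (x ⊗ₜ φ) z = φ z • x := by
  simp [TT]

/-- The coevaluation element, retyped. -/
noncomputable def coevE : IGcar G ⊗[ℤ] (IGcar G →ₗ[ℤ] ℤ) := coevElt G

lemma TT_coev : TT G (coevE G) = LinearMap.id := by
  change (dualTensorHomEquiv ℤ (IGcar G) (IGcar G)) ((TensorProduct.comm ℤ _ _)
    ((TensorProduct.comm ℤ _ _) (preElt G))) = _
  have : (TensorProduct.comm ℤ _ _) ((TensorProduct.comm ℤ _ _) (preElt G)) = preElt G :=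
    (TensorProduct.comm ℤ _ _).symm_apply_apply _
  rw [this]
  exact LinearEquiv.apply_symm_apply _ _

/-- `-(id + coev ev)` on pure tensors. -/
noncomputable def psiN (x : IGcar G) (φ : IGcar G →ₗ[ℤ] ℤ) : IGcar G ⊗[ℤ] (IGcar G →ₗ[ℤ] ℤ) :=
  (-(φ x)) • coevE G + (-x) ⊗ₜ[ℤ] φ

lemma TT_psiN (x z : IGcar G) (φ : IGcar G →ₗ[ℤ] ℤ) :
    TT G (psiN G x φ) z = - (φ x • z) - φ z • x := by
  unfold psiN
  rw [map_add, map_smul, TT_coev]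
  rw [LinearMap.add_apply, TT_tmul, LinearMap.smul_apply, LinearMap.id_apply, neg_smul, smul_neg,
    sub_eq_add_neg]

lemma psi_norm_aux (x : IGcar G) (φ : IGcar G →ₗ[ℤ] ℤ) :
    ∑ g : G, ∑ k : G, (cc G g x * φ (bb G k g)) • (bb G k g ⊗ₜ[ℤ] cc G k) = psiN G x φ := by
  classical
  apply (TT G).injective
  apply LinearMap.ext
  intro z
  rw [TT_psiN]
  have hl : TT G (∑ g : G, ∑ k : G, (cc G g x * φ (bb G k g)) • (bb G k g ⊗ₜ[ℤ] cc G k)) z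
      = ∑ g : G, ∑ k : G, (cc G g x * φ (bb G k g)) • (cc G k z • bb G k g) := by
    simp only [map_sum, LinearMap.sum_apply]
    refine Finset.sum_congr rfl fun g _ => Finset.sum_congr rfl fun k _ => ?_
    rw [map_smul, LinearMap.smul_apply]
    exact congrArg (fun t => (cc G g x * φ (bb G k g)) • t) (TT_tmul G (bb G k g) z (cc G k))
  refine hl.trans ?_
  apply ext_cc
  intro h
  simp only [map_sum, map_smul, cc_bb, smul_eq_mul, map_sub, map_neg, mul_sub,
    Finset.sum_sub_distrib]
  have a1 : φ (∑ g : G, cc G g x • bb G h g) = - φ x := by rw [sum_bb_left, map_neg]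
  have a2 : φ (∑ g : G, cc G g z • bb G g h) = φ z := by rw [sum_bb_right]
  simp only [map_sum, map_smul, smul_eq_mul] at a1 a2
  congr 1
  · simp
    rw [← Finset.sum_mul, a1]; ring
  · rw [Finset.sum_comm]
    simp
    rw [← a2, Finset.sum_mul]
    exact Finset.sum_congr rfl fun g _ => by ring

lemma psi_norm (x : IGcar G) (φ : IGcar G →ₗ[ℤ] ℤ) :
    ∑ g : G, TensorProduct.map ((IGrep G).ρ g) ((DIG G).ρ g)
      (psi G (TensorProduct.map ((IGrep G).ρ g⁻¹) ((DIG G).ρ g⁻¹) (x ⊗ₜ φ)))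
    = psiN G x φ := by
  classical
  have step : ∀ g : G, TensorProduct.map ((IGrep G).ρ g) ((DIG G).ρ g)
      (psi G (TensorProduct.map ((IGrep G).ρ g⁻¹) ((DIG G).ρ g⁻¹) (x ⊗ₜ φ)))
      = ∑ k : G, (cc G g x * φ (bb G k g)) • (bb G k g ⊗ₜ[ℤ] cc G k) := by
    intro g
    have e1 : TensorProduct.map ((IGrep G).ρ g⁻¹) ((DIG G).ρ g⁻¹) (x ⊗ₜ φ)
      = IGρ G g⁻¹ x ⊗ₜ[ℤ] (φ ∘ₗ IGρ G g) := by
        have : (DIG G).ρ g⁻¹ φ = φ ∘ₗ IGρ G g⁻¹⁻¹ := rfl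
        rw [inv_inv] at this
        refine (TensorProduct.map_tmul _ _ _ _).trans ?_
        exact congrArg (IGρ G g⁻¹ x ⊗ₜ[ℤ] ·) this
    have e2 : psi G (IGρ G g⁻¹ x ⊗ₜ[ℤ] (φ ∘ₗ IGρ G g)) =
        ∑ k : G, (cc G g x * φ (bb G (g * k) g)) • (bb G k 1 ⊗ₜ[ℤ] cc G k) := by
      simp [psi, cc_rho, rho_bb]
    refine (congrArg (fun t => TensorProduct.map ((IGrep G).ρ g) ((DIG G).ρ g) (psi G t)) e1).trans ?_
    refine (congrArg (fun t => TensorProduct.map ((IGrep G).ρ g) ((DIG G).ρ g) t) e2).trans ?_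
    refine (map_sum _ _ _).trans ?_
    refine Fintype.sum_equiv (Equiv.mulLeft g) _ _ fun k => ?_
    refine (map_smul _ _ _).trans ?_
    refine congrArg₂ (· • ·) rfl ?_
    refine (TensorProduct.map_tmul _ _ _ _).trans ?_
    have f1 : (IGrep G).ρ g (bb G k 1) = bb G (g * k) g := by
      refine (rho_bb G g k 1).trans ?_
      rw [mul_one]
    have f2 : (DIG G).ρ g (cc G k) = cc G (g * k) := by
      apply LinearMap.ext
      intro z
      refine (cc_rho G g⁻¹ k z).trans ?_
      rw [inv_inv]
      rfl
    exact congrArg₂ (· ⊗ₜ[ℤ] ·) f1 f2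
  refine (Finset.sum_congr rfl fun g _ => step g).trans (psi_norm_aux G x φ)

/-- Evaluation `I ⊗ I^∨ ⟶ ℤ`. -/
noncomputable def evv : IGrep G ⊗ DIG G ⟶ 𝟙_ (Rep ℤ G) :=
  (ihom.ev (IGrep G)).app (𝟙_ (Rep ℤ G))

lemma evv_tmul (x : IGcar G) (φ : IGcar G →ₗ[ℤ] ℤ) :
    (evv G).hom (x ⊗ₜ[ℤ] φ) = φ x := by
  change (evv G).hom.toLinearMap (x ⊗ₜ[ℤ] φ) = φ x
  unfold evv
  erw [Rep.ihom_ev_app_hom]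
  rfl

lemma finrank_IG : (Module.finrank ℤ (IGcar G) : ℤ) = Fintype.card G - 1 := by
  have h := Submodule.finrank_quotient_add_finrank (LinearMap.ker (aug G))
  rw [(aug G).quotKerEquivRange.finrank_eq] at h
  have h1 : LinearMap.range (aug G) = ⊤ := by
    rw [LinearMap.range_eq_top]
    intro z
    exact ⟨Finsupp.single 1 z, by simp [aug]⟩
  rw [h1, finrank_top] at h
  simp only [Module.finrank_self, Module.finrank_finsupp_self] at h
  change 1 + Module.finrank ℤ (IGcar G) = _ at h
  omega

lemma evv_coev : (evv G).hom (coevElt G) = (Fintype.card G - 1 : ℤ) := by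
  have key : ∀ t : Module.Dual ℤ (IGcar G) ⊗[ℤ] IGcar G,
      (evv G).hom (TensorProduct.comm ℤ _ _ t : IGcar G ⊗[ℤ] (IGcar G →ₗ[ℤ] ℤ)) = LinearMap.trace ℤ (IGcar G) (dualTensorHom ℤ _ _ t) := by
    intro t
    induction t with
    | zero =>
      simp only [map_zero]
      exact map_zero _
    | add a b ha hb =>
      simp only [map_add]
      rw [← ha, ← hb]
      exact map_add _ _ _
    | tmul φ x =>
      refine (evv_tmul G x φ).trans ?_
      simp
  refine (key (preElt G)).trans ?_
  have h2 : dualTensorHom ℤ (IGcar G) (IGcar G) (preElt G) = LinearMap.id :=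
    (dualTensorHomEquiv ℤ (IGcar G) (IGcar G)).apply_symm_apply LinearMap.id
  rw [h2, LinearMap.trace_id, finrank_IG]

lemma coev_apply (z : ℤ) : (coev G).hom z = z • coevElt G := rfl

lemma coev_stIso : StIso (coev G) := by
  refine ⟨-evv G, ?_, ?_⟩
  · refine ⟨-LinearMap.id, fun z => ?_⟩
    change ℤ at z
    have e1 : (coev G ≫ (-evv G) - 𝟙 _).hom z = - (evv G).hom (z • coevElt G) - z := rfl
    have e2 : (evv G).hom (z • coevElt G) = z • (Fintype.card G - 1 : ℤ) := by
      rw [← evv_coev]; exact map_smul _ _ _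
    refine e1.trans ?_
    rw [e2]
    have e3 : ∀ g : G, (𝟙_ (Rep ℤ G)).ρ g ((-LinearMap.id : ℤ →ₗ[ℤ] ℤ) ((𝟙_ (Rep ℤ G)).ρ g⁻¹ z))
      = -z := fun g => rfl
    refine Eq.trans ?_ (Finset.sum_congr rfl fun g _ => (e3 g).symm)
    refine Eq.trans ?_ (Finset.sum_const (-z)).symm
    have e4 : -(z * (Fintype.card G - 1 : ℤ)) - z = Finset.univ.card (α := G) • (-z) := by
      simp
      ring
    exact e4
  · refine ⟨psi G, fun t => ?_⟩
    change IGcar G ⊗[ℤ] (IGcar G →ₗ[ℤ] ℤ) at t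
    change _ = ∑ g : G, TensorProduct.map ((IGrep G).ρ g) ((DIG G).ρ g)
      (psi G (TensorProduct.map ((IGrep G).ρ g⁻¹) ((DIG G).ρ g⁻¹) t))
    let L : IGcar G ⊗[ℤ] (IGcar G →ₗ[ℤ] ℤ) →ₗ[ℤ] IGcar G ⊗[ℤ] (IGcar G →ₗ[ℤ] ℤ) :=
      ((-evv G) ≫ coev G - 𝟙 _).hom.toLinearMap
    let R : IGcar G ⊗[ℤ] (IGcar G →ₗ[ℤ] ℤ) →ₗ[ℤ] IGcar G ⊗[ℤ] (IGcar G →ₗ[ℤ] ℤ) :=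
      ∑ g : G, TensorProduct.map ((IGrep G).ρ g) ((DIG G).ρ g) ∘ₗ
      psi G ∘ₗ (TensorProduct.map ((IGrep G).ρ g⁻¹) ((DIG G).ρ g⁻¹))
    have hLR : L = R := by
      apply TensorProduct.ext'
      intro x φ
      have hR : R (x ⊗ₜ φ) = _ := (LinearMap.sum_apply _ _ _).trans (psi_norm G x φ)
      have e1 : L (x ⊗ₜ φ) = (-((evv G).hom (x ⊗ₜ[ℤ] φ)) : ℤ) • coevE G - x ⊗ₜ φ := rfl
      have e2 : (-(φ x) : ℤ) • coevE G - x ⊗ₜ φ = psiN G x φ := by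
        exact (sub_eq_add_neg _ _).trans (congrArg _ (TensorProduct.neg_tmul x φ).symm)
      refine e1.trans (Eq.trans ?_ (e2.trans hR.symm))
      exact congrArg (fun t : ℤ => (-t) • coevE G - x ⊗ₜ φ) (evv_tmul G x φ)
    exact (LinearMap.congr_fun hLR t).trans (LinearMap.sum_apply _ _ _)

end Coev

section Mu
variable {G : Type} [Group G] [Fintype G]

lemma StIso.hom {A B : Rep.{0} ℤ G} (e : A ≅ B) : StIso e.hom := StIso.of_isIso _

lemma StIso.inv {A B : Rep.{0} ℤ G} (e : A ≅ B) : StIso e.inv := StIso.of_isIso _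

lemma sMap_stIso (n : ℤ) : StIso (sMap (G := G) n) := by
  match n with
  | .ofNat m => exact StIso.of_isIso (𝟙 (Jp G m ⊗ IGrep G))
  | .negSucc 0 =>
    exact (coev_stIso G).comp ((StIso.hom (β_ _ _)).comp ((StIso.inv (λ_ _)).whiskerRight _))
  | .negSucc (m+1) =>
    exact (StIso.inv (ρ_ _)).comp
      ((((coev_stIso G).comp (StIso.hom (β_ _ _))).whiskerLeft _).comp (StIso.inv (α_ _ _ _)))

lemma tMap_stIso (n : ℤ) : StIso (tMap (G := G) n) := by
  match n with
  | .ofNat 0 => exact StIso.of_isIso (𝟙 (𝟙_ (Rep ℤ G) ⊗ DIG G))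
  | .ofNat (m+1) =>
    exact (StIso.of_isIso (eqToHom _)).comp ((StIso.inv (ρ_ _)).comp
      (((coev_stIso G).whiskerLeft _).comp (StIso.inv (α_ _ _ _))))
  | .negSucc m =>
    exact (StIso.of_isIso
      (eqToHom (show J G (Int.negSucc m - 1) = J G (Int.negSucc m) ⊗ DIG G from rfl)))

lemma μpos_stIso (i : ℤ) (m : ℕ) : StIso (μpos (G := G) i m) := by
  induction m with
  | zero => exact (StIso.of_isIso (eqToHom _)).comp (StIso.inv (ρ_ _))
  | succ m ih =>
    exact (StIso.of_isIso (eqToHom _)).comp ((sMap_stIso _).comp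
      ((ih.whiskerRight _).comp (StIso.hom (α_ _ _ _))))

lemma μneg_stIso (i : ℤ) (m : ℕ) : StIso (μneg (G := G) i m) := by
  induction m with
  | zero => exact (StIso.of_isIso (eqToHom _)).comp (StIso.inv (ρ_ _))
  | succ m ih =>
    exact (StIso.of_isIso (eqToHom _)).comp ((tMap_stIso _).comp
      ((ih.whiskerRight _).comp ((StIso.hom (α_ _ _ _)).comp
        ((StIso.of_isIso (eqToHom _)).whiskerLeft _))))

lemma μ_stIso (i j : ℤ) : StIso (μ G i j) := by
  match j with
  | .ofNat m => exact μpos_stIso i m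
  | .negSucc m => exact (StIso.of_isIso (eqToHom _)).comp (μneg_stIso i (m+1))

/-- The flipped comparison map. -/
noncomputable def nu (i j : ℤ) : J G (i + j) ⟶ J G j ⊗ J G i := μ G i j ≫ (β_ _ _).hom

lemma nu_stIso (i j : ℤ) : StIso (nu (G := G) i j) :=
  (μ_stIso i j).comp (StIso.hom (β_ _ _))

end Mu
end Enc

namespace Enc

section Cls
variable {G : Type} [Group G] [Fintype G]

/-- The class of a morphism `X ⊗ J n ⟶ A`. -/
noncomputable def cls {n : ℤ} {X A : Rep.{0} ℤ G} (f : X ⊗ J G n ⟶ A) : tate n (hRep X A) :=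
  mkCls (Rep.tensorHomEquiv X (J G n) A f)

lemma mkCls_surj {n : ℤ} {W : Rep.{0} ℤ G} (z : tate n W) : ∃ m : J G n ⟶ W, mkCls m = z := by
  obtain ⟨⟨v, hv⟩, rfl⟩ := Submodule.Quotient.mk_surjective _ z
  let w : (J G n).V →ₗ[ℤ] W.V := v
  have hv' : ∀ g : G, W.ρ g ∘ₗ (v : (J G n).V →ₗ[ℤ] W.V) ∘ₗ (J G n).ρ g⁻¹ = v := hv
  refine ⟨ConcreteCategory.ofHom (C := Rep ℤ G) { (v : (J G n).V →ₗ[ℤ] W.V) with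
    isIntertwining' := ?_ }, rfl⟩
  intro g
  apply LinearMap.ext
  intro x
  have := LinearMap.congr_fun (hv' g) ((J G n).ρ g x)
  have e : W.ρ g (w ((J G n).ρ g⁻¹ ((J G n).ρ g x))) = w ((J G n).ρ g x) := this
  rw [Representation.inv_self_apply] at e
  exact e.symm

lemma cls_surj {n : ℤ} {X A : Rep.{0} ℤ G} (z : tate n (hRep X A)) :
    ∃ f : X ⊗ J G n ⟶ A, cls f = z := by
  obtain ⟨m, rfl⟩ := mkCls_surj z
  refine ⟨(Rep.tensorHomEquiv X (J G n) A).symm m, ?_⟩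
  unfold cls
  rw [Equiv.apply_symm_apply]

lemma mkCls_add {n : ℤ} {W : Rep.{0} ℤ G} (a b : J G n ⟶ W) :
    mkCls (a + b) = mkCls a + mkCls b := rfl

lemma cls_add {n : ℤ} {X A : Rep.{0} ℤ G} (f g : X ⊗ J G n ⟶ A) :
    cls (f + g) = cls f + cls g := by
  have : Rep.tensorHomEquiv X (J G n) A (f + g) =
    Rep.tensorHomEquiv X (J G n) A f + Rep.tensorHomEquiv X (J G n) A g := rfl
  unfold cls
  rw [this, mkCls_add]

lemma mkCls_eq_iff {n : ℤ} {W : Rep.{0} ℤ G} (a b : J G n ⟶ W) :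
    mkCls a = mkCls b ↔ StEq a b := by
  constructor
  · intro h
    obtain ⟨u, hu⟩ := (Submodule.Quotient.eq _).1 h
    have hu' : rnorm ((hRep (J G n) W).ρ) u = a.hom.toLinearMap - b.hom.toLinearMap :=
      congrArg Subtype.val hu
    refine ⟨u, fun x => ?_⟩
    have h1 : rnorm ((hRep (J G n) W).ρ) u = ∑ h : G, ((hRep (J G n) W).ρ h) u :=
      LinearMap.sum_apply _ _ _
    refine (LinearMap.congr_fun (hu'.symm.trans h1) x).trans ?_
    exact LinearMap.sum_apply _ _ _
  · rintro ⟨u, hu⟩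
    refine (Submodule.Quotient.eq _).2 ⟨u, ?_⟩
    apply Subtype.ext
    have h1 : rnorm ((hRep (J G n) W).ρ) u = ∑ h : G, ((hRep (J G n) W).ρ h) u :=
      LinearMap.sum_apply _ _ _
    refine h1.trans ?_
    refine LinearMap.ext fun x => Eq.trans ?_ (hu x).symm
    exact LinearMap.sum_apply _ _ _

lemma tHE_norm_iff {k : Type} [CommRing k] {X B A : Rep.{0} k G} (f : X ⊗ B ⟶ A) :
    (∃ u : B.V →ₗ[k] ((Rep.ihom X).obj A).V, ∀ b : B.V, (Rep.tensorHomEquiv X B A f).hom b =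
      ∑ g : G, ((Rep.ihom X).obj A).ρ g (u (B.ρ g⁻¹ b))) ↔
    (∃ u : (X ⊗ B).V →ₗ[k] A.V, ∀ t : (X ⊗ B).V, f.hom t =
      ∑ g : G, A.ρ g (u ((X ⊗ B).ρ g⁻¹ t))) := by
  constructor
  · rintro ⟨u, hu⟩
    let u' : B.V →ₗ[k] X.V →ₗ[k] A.V := u
    refine ⟨TensorProduct.lift u'.flip, fun t => ?_⟩
    have e : f.hom.toLinearMap = (∑ g : G, A.ρ g ∘ₗ TensorProduct.lift u'.flip ∘ₗ
        TensorProduct.map (X.ρ g⁻¹) (B.ρ g⁻¹) : X.V ⊗[k] B.V →ₗ[k] A.V) := by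
      apply TensorProduct.ext'
      intro x b
      refine Eq.trans (LinearMap.congr_fun (hu b) x) ?_
      refine (LinearMap.sum_apply _ _ _).trans ?_
      symm
      exact LinearMap.sum_apply _ _ _
    exact (LinearMap.congr_fun e t).trans (LinearMap.sum_apply _ _ _)
  · rintro ⟨u, hu⟩
    let u' : X.V ⊗[k] B.V →ₗ[k] A.V := u
    refine ⟨(TensorProduct.curry u').flip, fun b => ?_⟩
    refine LinearMap.ext fun x => ?_
    refine (hu (x ⊗ₜ[k] b)).trans ?_
    symm
    exact LinearMap.sum_apply _ _ _

lemma stEq_tHE {X B A : Rep.{0} ℤ G} (f g : X ⊗ B ⟶ A) :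
    StEq (Rep.tensorHomEquiv X B A f) (Rep.tensorHomEquiv X B A g) ↔ StEq f g :=
  tHE_norm_iff (f - g)

lemma cls_eq_iff {n : ℤ} {X A : Rep.{0} ℤ G} (f g : X ⊗ J G n ⟶ A) :
    cls f = cls g ↔ StEq f g :=
  (mkCls_eq_iff _ _).trans (stEq_tHE f g)

lemma tmap_cls (n : ℤ) {X A B : Rep.{0} ℤ G} (φ : A ⟶ B) (f : X ⊗ J G n ⟶ A) :
    tmap n ((Rep.ihom X).map φ) (cls f) = cls (f ≫ φ) := rfl

lemma tcast_cls {n m : ℤ} {X A : Rep.{0} ℤ G} (h : n = m) (f : X ⊗ J G n ⟶ A) :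
    tcast h (cls f) = cls (X ◁ eqToHom (congrArg (J G) h.symm) ≫ f) := by
  subst h
  simp [tcast]

lemma tHE_curry {k : Type} [CommRing k] {X B A : Rep.{0} k G} (f : X ⊗ B ⟶ A) :
    MonoidalClosed.curry f = Rep.tensorHomEquiv X B A f := by
  rw [← Rep.homEquiv_def]; rfl

lemma comp_abs {C : Type*} [Category C] [MonoidalCategory C] [BraidedCategory C]
    {X X' A I K H1 H2 : C} (a : I ⟶ H2) (b : K ⟶ H1) (e1 : X' ⊗ H1 ⟶ X) (e2 : X ⊗ H2 ⟶ A)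
    (c : X ⊗ I ⟶ A) (m : X' ⊗ K ⟶ X) (hm : X' ◁ b ≫ e1 = m) (hc : X ◁ a ≫ e2 = c) :
    X' ◁ (a ⊗ₘ b) ≫ X' ◁ (β_ H2 H1).hom ≫ (α_ X' H1 H2).inv ≫ e1 ▷ H2 ≫ e2 =
      X' ◁ (β_ I K).hom ≫ (α_ X' K I).inv ≫ m ▷ I ≫ c := by
  subst hm hc
  rw [← whiskerLeft_comp_assoc, BraidedCategory.braiding_naturality, MonoidalCategory.tensorHom_def]
  simp only [whiskerLeft_comp, Category.assoc, associator_inv_naturality_right_assoc,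
    associator_inv_naturality_middle_assoc, comp_whiskerRight, whisker_exchange_assoc]

lemma comp_key {i j : ℤ} {X X' A : Rep.{0} ℤ G} (c : X ⊗ J G i ⟶ A) (m : X' ⊗ J G j ⟶ X) :
   (Rep.tensorHomEquiv X (J G i) A c ⊗ₘ Rep.tensorHomEquiv X' (J G j) X m) ≫ compPair X' X A
   = Rep.tensorHomEquiv X' _ A (X' ◁ (β_ (J G i) (J G j)).hom ≫ (α_ X' (J G j) (J G i)).inv ≫
      m ▷ J G i ≫ c) := by
  rw [← tHE_curry, ← tHE_curry, ← tHE_curry]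
  unfold compPair
  apply MonoidalClosed.uncurry_injective
  refine (MonoidalClosed.uncurry_natural_left _ _).trans ?_
  rw [MonoidalClosed.uncurry_curry, MonoidalClosed.uncurry_curry]
  exact comp_abs _ _ _ _ _ _ (MonoidalClosed.uncurry_curry m) (MonoidalClosed.uncurry_curry c)

/-- The composition underlying the cup product. -/
noncomputable def cm {i j : ℤ} {X X' A : Rep.{0} ℤ G} (c : X ⊗ J G i ⟶ A) (m : X' ⊗ J G j ⟶ X) :
    X' ⊗ J G (i + j) ⟶ A :=
  X' ◁ nu i j ≫ (α_ X' (J G j) (J G i)).inv ≫ m ▷ J G i ≫ c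

lemma ccup_cls {i j : ℤ} {X X' A : Rep.{0} ℤ G} (c : X ⊗ J G i ⟶ A) (m : X' ⊗ J G j ⟶ X) :
    ccup (cls c) (cls m) = cls (cm c m) := by
  have e1 : ccup (cls c) (cls m) = mkCls (μ G i j ≫
    ((Rep.tensorHomEquiv X (J G i) A c) ⊗ₘ (Rep.tensorHomEquiv X' (J G j) X m)) ≫ compPair X' X A) := rfl
  rw [e1]
  unfold cls
  refine congrArg mkCls ?_
  rw [comp_key]
  rfl

end Cls
end Enc

namespace Enc

section Main
variable {G : Type} [Group G] [Fintype G]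

lemma cm_add_left {i j : ℤ} {X X' A : Rep.{0} ℤ G} (c₁ c₂ : X ⊗ J G i ⟶ A)
    (m : X' ⊗ J G j ⟶ X) : cm (c₁ + c₂) m = cm c₁ m + cm c₂ m := by
  unfold cm
  simp only [Preadditive.comp_add]

lemma cm_add_right {i j : ℤ} {X X' A : Rep.{0} ℤ G} (c : X ⊗ J G i ⟶ A)
    (m₁ m₂ : X' ⊗ J G j ⟶ X) : cm c (m₁ + m₂) = cm c m₁ + cm c m₂ := by
  have : (m₁ + m₂) ▷ J G i = m₁ ▷ J G i + m₂ ▷ J G i :=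
    ((tensoringRight (Rep.{0} ℤ G)).obj (J G i)).map_add
  unfold cm
  rw [this]
  simp only [Preadditive.comp_add, Preadditive.add_comp]

lemma cm_whisk {i j : ℤ} {X X' A : Rep.{0} ℤ G} (c : X ⊗ J G i ⟶ A)
    (m : X' ⊗ J G j ⟶ X) (v : X' ⟶ X') :
    v ▷ J G (i + j) ≫ cm c m = cm c (v ▷ J G j ≫ m) := by
  unfold cm
  rw [← whisker_exchange_assoc]
  simp

lemma zero_abs {C : Type*} [Category C] [MonoidalCategory C] [BraidedCategory C]
    {X' A J J' : C} (h : J = J') (h' : J' = J) (m : X' ⊗ J ⟶ A) (v : X' ⟶ X') :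
    X' ◁ eqToHom h ≫ X' ◁ ((eqToHom h' ≫ (ρ_ J).inv) ≫ (β_ J (𝟙_ C)).hom) ≫
      (α_ X' (𝟙_ C) J).inv ≫ ((ρ_ X').hom ≫ v) ▷ J ≫ m = v ▷ J ≫ m := by
  subst h
  simp [← whiskerLeft_comp_assoc]

lemma ccupTo_zero {r : ℤ} {X' A : Rep.{0} ℤ G} (m : X' ⊗ J G r ⟶ A) (v : X' ⟶ X') :
    ccupTo (cls m) (cls (n := 0) ((ρ_ X').hom ≫ v)) (add_zero r) = cls (v ▷ J G r ≫ m) := by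
  unfold ccupTo
  rw [ccup_cls, tcast_cls]
  refine congrArg cls ?_
  exact zero_abs _ (congrArg (J G) (add_zero r)) m v

lemma cls_zero_surj {X' : Rep.{0} ℤ G} (z : tate 0 (hRep X' X')) :
    ∃ v : X' ⟶ X', cls (n := 0) ((ρ_ X').hom ≫ v) = z := by
  obtain ⟨f, rfl⟩ := cls_surj z
  refine ⟨(ρ_ X').inv ≫ f, ?_⟩
  refine congrArg cls ?_
  exact Iso.hom_inv_id_assoc (ρ_ X') f

lemma theta_exists (j : ℤ) : ∃ θ : 𝟙_ (Rep.{0} ℤ G) ⟶ J G j ⊗ J G (-j), StIso θ :=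
  ⟨eqToHom (congrArg (J G) (show (0 : ℤ) = -j + j by omega)) ≫ nu (-j) j,
    (StIso.of_isIso (eqToHom _)).comp (nu_stIso _ _)⟩

/-- Stable unit map. -/
noncomputable def TU (j : ℤ) (A : Rep.{0} ℤ G) : A ⟶ (A ⊗ J G j) ⊗ J G (-j) :=
  (ρ_ A).inv ≫ A ◁ (theta_exists j).choose ≫ (α_ _ _ _).inv

lemma TU_stIso (j : ℤ) (A : Rep.{0} ℤ G) : StIso (TU j A) :=
  (StIso.inv (ρ_ A)).comp (((theta_exists j).choose_spec.whiskerLeft A).comp (StIso.inv (α_ _ _ _)))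

lemma TU_nat (j : ℤ) {A B : Rep.{0} ℤ G} (f : A ⟶ B) :
    f ≫ TU j B = TU j A ≫ (f ▷ J G j) ▷ J G (-j) := by
  unfold TU
  simp only [Category.assoc, ← associator_inv_naturality_left, ← whisker_exchange_assoc,
    rightUnitor_inv_naturality_assoc]

lemma faithful (j : ℤ) {A B : Rep.{0} ℤ G} {f g : A ⟶ B} (h : StEq (f ▷ J G j) (g ▷ J G j)) :
    StEq f g := by
  apply (TU_stIso j B).cancel_right
  rw [TU_nat, TU_nat]
  exact (h.whiskerRight _).precomp _

lemma full (j : ℤ) {A B : Rep.{0} ℤ G} (w : A ⊗ J G j ⟶ B ⊗ J G j) :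
    ∃ u : A ⟶ B, StEq (u ▷ J G j) w := by
  obtain ⟨k, h1, h2⟩ := TU_stIso j B
  refine ⟨TU j A ≫ w ▷ J G (-j) ≫ k, ?_⟩
  apply faithful (-j)
  apply (TU_stIso j A).cancel_left
  rw [← TU_nat]
  have := h2.precomp (TU j A ≫ w ▷ J G (-j))
  simpa only [Category.assoc, Category.comp_id] using this

lemma StIso.exists_inv {A B : Rep.{0} ℤ G} {f : A ⟶ B} (h : StIso f) :
    ∃ k : B ⟶ A, StIso k := by
  obtain ⟨k, h1, h2⟩ := h
  exact ⟨k, f, h2, h1⟩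

lemma descend (j : ℤ) {A B : Rep.{0} ℤ G} (s : A ⊗ J G j ⟶ B ⊗ J G j) (hs : StIso s) :
    ∃ x : A ⟶ B, StIso x := by
  obtain ⟨k, hk⟩ := (TU_stIso j B).exists_inv
  exact ⟨TU j A ≫ s ▷ J G (-j) ≫ k, (TU_stIso j A).comp ((hs.whiskerRight _).comp hk)⟩

lemma encoding_stIso {r : ℤ} {X X' : Rep.{0} ℤ G} (h : IsEncodingPair r X X') :
    ∃ x : X' ⊗ J G r ⟶ X, StIso x := by
  obtain ⟨j, e, he⟩ := h
  obtain ⟨p, hp⟩ := cls_surj (e (X ⊗ J G j) (cls (𝟙 _)))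
  have key : ∀ {B : Rep.{0} ℤ G} (f : X ⊗ J G j ⟶ B), e B (cls f) = cls (p ≫ f) := by
    intro B f
    have := he f (cls (𝟙 (X ⊗ J G j)))
    rw [← hp, tmap_cls, tmap_cls, Category.id_comp] at this
    exact this
  have hps : StIso p := by
    obtain ⟨z, hz⟩ := (e (X' ⊗ J G (j + r))).surjective (cls (𝟙 _))
    obtain ⟨q, rfl⟩ := cls_surj z
    rw [key, cls_eq_iff] at hz
    refine ⟨q, hz, ?_⟩
    rw [← cls_eq_iff]
    apply (e _).injective
    rw [key, key, cls_eq_iff]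
    have := hz.comp p
    simpa only [Category.assoc, Category.comp_id, Category.id_comp] using this
  obtain ⟨k, hk⟩ := ((nu_stIso (G := G) j r).whiskerLeft X').exists_inv
  exact descend j ((α_ X' (J G r) (J G j)).hom ≫ k ≫ p) ((StIso.hom (α_ _ _ _)).comp (hk.comp hps))

end Main
end Enc

open CategoryTheory MonoidalCategory Enc

theorem statement15 (G : Type) [Group G] [Fintype G] (r : ℤ) (X X' : Rep ℤ G)
    (h : IsEncodingPair r X X') (A : Rep ℤ G) (i : ℤ) :
    (∀ (c : tate i (hRep X A)) (m₁ m₂ : tate r (hRep X' X)),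
        ccup c (m₁ + m₂) = ccup c m₁ + ccup c m₂) ∧
    (∀ (c₁ c₂ : tate i (hRep X A)) (m : tate r (hRep X' X)),
        ccup (c₁ + c₂) m = ccup c₁ m + ccup c₂ m) ∧
    (∀ (c : tate i (hRep X A)) (m : tate r (hRep X' X)) (u : tate 0 (hRep X' X')),
        ccup c (ccupTo m u (add_zero r)) = ccupTo (ccup c m) u (add_zero (i + r))) ∧
    (∀ c₁ c₂ : tate i (hRep X A), (∀ m : tate r (hRep X' X), ccup c₁ m = ccup c₂ m) → c₁ = c₂) ∧
    (∀ h : tate r (hRep X' X) → tate (i + r) (hRep X' A),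
        (∀ m₁ m₂, h (m₁ + m₂) = h m₁ + h m₂) →
        (∀ (m : tate r (hRep X' X)) (u : tate 0 (hRep X' X')),
            h (ccupTo m u (add_zero r)) = ccupTo (h m) u (add_zero (i + r))) →
        ∃ c : tate i (hRep X A), ∀ m : tate r (hRep X' X), h m = ccup c m) := by
  obtain ⟨x, hx⟩ := encoding_stIso h
  have part3 : ∀ (c : tate i (hRep X A)) (m : tate r (hRep X' X)) (u : tate 0 (hRep X' X')),
      ccup c (ccupTo m u (add_zero r)) = ccupTo (ccup c m) u (add_zero (i + r)) := by
    intro c m u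
    obtain ⟨c, rfl⟩ := cls_surj c
    obtain ⟨m, rfl⟩ := cls_surj m
    obtain ⟨v, rfl⟩ := cls_zero_surj u
    rw [ccupTo_zero, ccup_cls, ccup_cls, ccupTo_zero, cm_whisk]
  have hQ : StIso (X' ◁ nu i r ≫ (α_ X' (J G r) (J G i)).inv ≫ x ▷ J G i) :=
    ((nu_stIso i r).whiskerLeft X').comp
      ((StIso.inv (α_ X' (J G r) (J G i))).comp (hx.whiskerRight _))
  have hcm : ∀ c : X ⊗ J G i ⟶ A,
      cm c x = (X' ◁ nu i r ≫ (α_ X' (J G r) (J G i)).inv ≫ x ▷ J G i) ≫ c := by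
    intro c
    unfold cm
    simp only [Category.assoc]
  refine ⟨?_, ?_, part3, ?_, ?_⟩
  · intro c m₁ m₂
    obtain ⟨c, rfl⟩ := cls_surj c
    obtain ⟨m₁, rfl⟩ := cls_surj m₁
    obtain ⟨m₂, rfl⟩ := cls_surj m₂
    rw [← cls_add, ccup_cls, ccup_cls, ccup_cls, cm_add_right, cls_add]
  · intro c₁ c₂ m
    obtain ⟨c₁, rfl⟩ := cls_surj c₁
    obtain ⟨c₂, rfl⟩ := cls_surj c₂
    obtain ⟨m, rfl⟩ := cls_surj m
    rw [← cls_add, ccup_cls, ccup_cls, ccup_cls, cm_add_left, cls_add]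
  · intro c₁ c₂ hc
    obtain ⟨c₁, rfl⟩ := cls_surj c₁
    obtain ⟨c₂, rfl⟩ := cls_surj c₂
    have := hc (cls x)
    rw [ccup_cls, ccup_cls, cls_eq_iff, hcm, hcm] at this
    rw [cls_eq_iff]
    exact hQ.cancel_left this
  · intro f _ hlin
    obtain ⟨H, hH⟩ := cls_surj (f (cls x))
    obtain ⟨k, h1, _⟩ := hQ
    have hfx : f (cls x) = ccup (cls (k ≫ H)) (cls x) := by
      rw [← hH, ccup_cls, cls_eq_iff, hcm, ← Category.assoc]
      have := (h1.comp H).symm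
      rwa [Category.id_comp] at this
    refine ⟨cls (k ≫ H), fun m => ?_⟩
    obtain ⟨m, rfl⟩ := cls_surj m
    obtain ⟨y, hy1, hy2⟩ := hx
    obtain ⟨u, hu⟩ := full r (m ≫ y)
    have hm : cls m = ccupTo (cls x) (cls (n := 0) ((ρ_ X').hom ≫ u)) (add_zero r) := by
      rw [ccupTo_zero, cls_eq_iff]
      have e1 := hu.comp x
      have e2 := hy2.precomp m
      rw [Category.comp_id, ← Category.assoc] at e2
      exact (e1.trans e2).symm
    rw [hm, hlin, hfx, part3]
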